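/- Let p be a prime, q a power of p with q > 2, and n a positive integer. Write T = T(n,q), U = U(n,q), D = D(n,q). Then |T^p| = Σ_δ |D_δ(n,q)| · [U : C_U(d_δ)] · |C_U(d_δ)^p|, where the sum runs over all partitions δ of n of length at most q−1, d_δ is any fixed element of D_δ(n,q), and [U : C_U(d_δ)] denotes the index of the centralizer of d_δ in U. -/

import Mathlib

/-- A matrix is lower unitriangular: all diagonal entries are `1` and all entries
above the diagonal are `0`. -/
def IsUnitriangular {n : ℕ} {F : Type*} [Field F] (A : Matrix (Fin n) (Fin n) F) : Prop :=
  (∀ i, A i i = 1) ∧ ∀ i j : Fin n, i < j → A i j = 0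

/-- A matrix is invertible lower triangular: all entries above the diagonal are `0`
and all diagonal entries are nonzero. -/
def IsTriangular {n : ℕ} {F : Type*} [Field F] (A : Matrix (Fin n) (Fin n) F) : Prop :=
  (∀ i j : Fin n, i < j → A i j = 0) ∧ ∀ i, A i i ≠ 0

/-- The type of an invertible diagonal matrix, encoded by its diagonal
`d : Fin n → F`: the multiset of the sizes of the fibers of `d`. -/
def typeMultiset {n : ℕ} {F : Type*} [DecidableEq F] (d : Fin n → F) : Multiset ℕ :=
  (Finset.image d Finset.univ).val.map fun c => (Finset.univ.filter fun i => d i = c).card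

/-- The centralizer of the diagonal matrix with diagonal `d` inside the group of
lower unitriangular matrices, as a set of matrices. -/
def centralizerU {n : ℕ} {F : Type*} [Field F] (d : Fin n → F) :
    Set (Matrix (Fin n) (Fin n) F) :=
  {u | IsUnitriangular u ∧ u * Matrix.diagonal d = Matrix.diagonal d * u}

namespace pPowerPaper

open Matrix OrderDual

section Triangular

variable {n : ℕ} {F : Type*} [Field F]

theorem diag_mul_of_lower {A B : Matrix (Fin n) (Fin n) F}
    (hA : A.BlockTriangular toDual) (hB : B.BlockTriangular toDual) (i : Fin n) :
    (A * B) i i = A i i * B i i := by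
  rw [Matrix.mul_apply]
  refine Finset.sum_eq_single i (fun j _ hj => ?_) (by simp)
  rcases lt_or_gt_of_ne hj with h | h
  · rw [hB (toDual_lt_toDual.mpr h), mul_zero]
  · rw [hA (toDual_lt_toDual.mpr h), zero_mul]

theorem lower_pow {A : Matrix (Fin n) (Fin n) F} (hA : A.BlockTriangular toDual) (k : ℕ) :
    (A ^ k).BlockTriangular toDual := by
  induction k with
  | zero => simpa using blockTriangular_one
  | succ k ih => rw [pow_succ]; exact ih.mul hA

theorem diag_pow_of_lower {A : Matrix (Fin n) (Fin n) F} (hA : A.BlockTriangular toDual)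
    (k : ℕ) (i : Fin n) : (A ^ k) i i = A i i ^ k := by
  induction k with
  | zero => simp
  | succ k ih => rw [pow_succ, diag_mul_of_lower (lower_pow hA k) hA, ih, pow_succ]

theorem isUnitriangular_iff {A : Matrix (Fin n) (Fin n) F} :
    IsUnitriangular A ↔ (∀ i, A i i = 1) ∧ A.BlockTriangular toDual := Iff.rfl

theorem isTriangular_iff {A : Matrix (Fin n) (Fin n) F} :
    IsTriangular A ↔ A.BlockTriangular toDual ∧ ∀ i, A i i ≠ 0 := Iff.rfl

theorem isUnitriangular_one : IsUnitriangular (1 : Matrix (Fin n) (Fin n) F) :=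
  ⟨fun i => by simp, blockTriangular_one (b := toDual)⟩

theorem _root_.IsUnitriangular.lower {A : Matrix (Fin n) (Fin n) F} (hA : IsUnitriangular A) :
    A.BlockTriangular toDual := (isUnitriangular_iff.mp hA).2

theorem _root_.IsUnitriangular.mul {A B : Matrix (Fin n) (Fin n) F} (hA : IsUnitriangular A)
    (hB : IsUnitriangular B) : IsUnitriangular (A * B) :=
  ⟨fun i => by rw [diag_mul_of_lower hA.lower hB.lower, hA.1, hB.1, one_mul],
    hA.lower.mul hB.lower⟩

theorem _root_.IsUnitriangular.pow {A : Matrix (Fin n) (Fin n) F} (hA : IsUnitriangular A) (k : ℕ) :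
    IsUnitriangular (A ^ k) :=
  ⟨fun i => by rw [diag_pow_of_lower hA.lower, hA.1, one_pow], lower_pow hA.lower k⟩

theorem _root_.IsUnitriangular.sub_one_pow_eq_zero {A : Matrix (Fin n) (Fin n) F}
    (hA : IsUnitriangular A) : (A - 1) ^ n = 0 := by
  have key : ∀ k : ℕ, ∀ i j : Fin n, (i : ℕ) < j + k → ((A - 1) ^ k) i j = 0 := by
    intro k
    induction k with
    | zero =>
      intro i j h
      have : i ≠ j := by rintro rfl; simp at h
      simp [this]
    | succ k ih =>
      intro i j h
      rw [pow_succ, Matrix.mul_apply]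
      refine Finset.sum_eq_zero fun l _ => ?_
      rcases lt_trichotomy l j with hl | rfl | hl
      · simp [hA.2 l j hl, hl.ne]
      · simp [hA.1]
      · rw [ih i l (by have : (j : ℕ) < l := hl; omega), zero_mul]
  ext i j
  exact key n i j (by omega)

theorem _root_.IsUnitriangular.isUnit_det {A : Matrix (Fin n) (Fin n) F} (hA : IsUnitriangular A) :
    IsUnit A.det := by
  rw [Matrix.det_of_isLowerTriangular A hA.lower]
  simp [hA.1]

theorem _root_.IsUnitriangular.inv {A : Matrix (Fin n) (Fin n) F} (hA : IsUnitriangular A) :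
    IsUnitriangular A⁻¹ := by
  have := A.invertibleOfIsUnitDet hA.isUnit_det
  have hL : A⁻¹.BlockTriangular toDual := blockTriangular_inv_of_blockTriangular hA.lower
  refine ⟨fun i => ?_, hL⟩
  have h := diag_mul_of_lower hA.lower hL i
  rwa [Matrix.mul_nonsing_inv _ hA.isUnit_det, one_apply_eq, hA.1, one_mul, eq_comm] at h

theorem conj_pow_of_isUnitriangular {g : Matrix (Fin n) (Fin n) F} (hg : IsUnitriangular g)
    (X : Matrix (Fin n) (Fin n) F) (k : ℕ) : (g * X * g⁻¹) ^ k = g * X ^ k * g⁻¹ := by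
  induction k with
  | zero => simp [Matrix.mul_nonsing_inv _ hg.isUnit_det]
  | succ k ih =>
    rw [pow_succ, ih, pow_succ]
    simp only [Matrix.mul_assoc, Matrix.nonsing_inv_mul_cancel_left _ _ hg.isUnit_det]

theorem diag_conj_of_isUnitriangular {g X : Matrix (Fin n) (Fin n) F} (hg : IsUnitriangular g)
    (hX : X.BlockTriangular toDual) (i : Fin n) : (g * X * g⁻¹) i i = X i i := by
  rw [diag_mul_of_lower (hg.lower.mul hX) hg.inv.lower, diag_mul_of_lower hg.lower hX, hg.1,
    hg.inv.1, one_mul, mul_one]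

theorem mem_centralizerU_iff {d : Fin n → F} {u : Matrix (Fin n) (Fin n) F} :
    u ∈ centralizerU d ↔ IsUnitriangular u ∧ ∀ i j, u i j = 0 ∨ d i = d j := by
  refine and_congr_right fun _ => ?_
  rw [← Matrix.ext_iff]
  refine forall₂_congr fun i j => ?_
  rw [mul_diagonal, diagonal_mul, mul_comm (d i), mul_eq_mul_left_iff, or_comm, eq_comm (a := d j)]

theorem one_mem_centralizerU (d : Fin n → F) : 1 ∈ centralizerU d :=
  ⟨isUnitriangular_one, by simp⟩

theorem mul_mem_centralizerU {d : Fin n → F} {u v : Matrix (Fin n) (Fin n) F}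
    (hu : u ∈ centralizerU d) (hv : v ∈ centralizerU d) : u * v ∈ centralizerU d :=
  ⟨hu.1.mul hv.1, Commute.mul_left (show Commute u (diagonal d) from hu.2) hv.2⟩

theorem pow_mem_centralizerU {d : Fin n → F} {u : Matrix (Fin n) (Fin n) F}
    (hu : u ∈ centralizerU d) (k : ℕ) : u ^ k ∈ centralizerU d :=
  ⟨hu.1.pow k, Commute.pow_left (show Commute u (diagonal d) from hu.2) k⟩

theorem inv_mem_centralizerU {d : Fin n → F} {u : Matrix (Fin n) (Fin n) F}
    (hu : u ∈ centralizerU d) : u⁻¹ ∈ centralizerU d := by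
  refine ⟨hu.1.inv, ?_⟩
  have h := congrArg (fun X => u⁻¹ * X * u⁻¹) hu.2
  simp only [Matrix.mul_assoc, Matrix.nonsing_inv_mul_cancel_left _ _ hu.1.isUnit_det,
    Matrix.mul_nonsing_inv _ hu.1.isUnit_det, mul_one] at h
  exact h.symm

/-- The `k`-th powers of the elements of the centralizer of `diagonal d`. -/
def centralizerPowers (k : ℕ) (d : Fin n → F) : Set (Matrix (Fin n) (Fin n) F) :=
  {v | ∃ u ∈ centralizerU d, u ^ k = v}

theorem centralizerPowers_subset (k : ℕ) (d : Fin n → F) :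
    centralizerPowers k d ⊆ centralizerU d := by
  rintro _ ⟨u, hu, rfl⟩
  exact pow_mem_centralizerU hu k

/-- The conjugates under the unitriangular group of the products `diagonal d * w`, `w ∈ P`. -/
def conjugates (d : Fin n → F) (P : Set (Matrix (Fin n) (Fin n) F)) :
    Set (Matrix (Fin n) (Fin n) F) :=
  {B | ∃ g, IsUnitriangular g ∧ ∃ w ∈ P, B = g * (diagonal d * w) * g⁻¹}

theorem centralizerU_pow_char (p : ℕ) [Fact p.Prime] [CharP F p] (a : Fin n → F) :
    centralizerU (fun i => a i ^ p) = centralizerU a := by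
  ext u
  rw [mem_centralizerU_iff, mem_centralizerU_iff]
  exact and_congr_right fun _ => forall₂_congr fun i j =>
    or_congr_right (frobenius_inj F p).eq_iff

end Triangular

section Finite

variable {n : ℕ} {F : Type*} [Field F] [Fintype F]

theorem _root_.IsUnitriangular.pow_card_pow_eq_one {A : Matrix (Fin n) (Fin n) F}
    (hA : IsUnitriangular A) : A ^ Fintype.card F ^ n = 1 := by
  rcases Nat.eq_zero_or_pos n with rfl | hn
  · exact Subsingleton.elim _ _
  have : Nonempty (Fin n) := ⟨⟨0, hn⟩⟩
  obtain ⟨p, hchar⟩ := CharP.exists F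
  obtain ⟨e, hp, hcard⟩ := FiniteField.card F p
  have : Fact p.Prime := ⟨hp⟩
  have hle : n ≤ Fintype.card F ^ n := (Nat.lt_pow_self Fintype.one_lt_card).le
  have hsub : (A - 1) ^ p ^ (e * n : ℕ) = A ^ p ^ (e * n : ℕ) - 1 ^ p ^ (e * n : ℕ) :=
    sub_pow_char_pow_of_commute _ _ (Commute.one_right A)
  rw [pow_mul p, ← hcard, one_pow] at hsub
  rw [← sub_eq_zero, ← hsub, ← Nat.sub_add_cancel hle, pow_add, hA.sub_one_pow_eq_zero, mul_zero]

theorem diagonal_pow_card_pow (d : Fin n → F) (m : ℕ) :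
    diagonal d ^ Fintype.card F ^ m = diagonal d := by
  rw [diagonal_pow]
  congr 1
  ext i
  simp [FiniteField.pow_card_pow]

/-- The `q ^ n`-th power of a triangular matrix is its semisimple part. -/
theorem exists_isUnitriangular_pow_mul_eq {A : Matrix (Fin n) (Fin n) F} (hA : IsTriangular A) :
    ∃ g, IsUnitriangular g ∧
      A ^ Fintype.card F ^ n * g = g * diagonal fun i => A i i := by
  classical
  set q := Fintype.card F with hq
  have hL : A.BlockTriangular toDual := (isTriangular_iff.mp hA).1
  set S := A ^ q ^ n with hS
  have hSL : S.BlockTriangular toDual := lower_pow hL _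
  have hSd (i : Fin n) : S i i = A i i := by
    rw [hS, diag_pow_of_lower hL, FiniteField.pow_card_pow]
  have hS1 : S ^ (q - 1) = 1 := by
    have hU : IsUnitriangular (A ^ (q - 1)) :=
      ⟨fun i => by rw [diag_pow_of_lower hL, FiniteField.pow_card_sub_one_eq_one _ (hA.2 i)],
        lower_pow hL _⟩
    rw [hS, ← pow_mul, mul_comm, pow_mul, hU.pow_card_pow_eq_one]
  set E : Matrix (Fin n) (Fin n) F := diagonal fun i => (A i i)⁻¹ with hE
  have hE1 : E ^ (q - 1) = 1 := by
    rw [hE, diagonal_pow, ← diagonal_one]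
    congr 1
    ext i
    simpa using FiniteField.pow_card_sub_one_eq_one _ (hA.2 i)
  have hED : E * diagonal (fun i => A i i) = 1 := by
    rw [hE, diagonal_mul_diagonal, ← diagonal_one]
    congr 1
    ext i
    exact inv_mul_cancel₀ (hA.2 i)
  have hEL : E.BlockTriangular toDual := blockTriangular_diagonal _
  have hterm (k : ℕ) : (S ^ k * E ^ k).BlockTriangular toDual :=
    (lower_pow hSL k).mul (lower_pow hEL k)
  set g := -∑ k ∈ Finset.range (q - 1), S ^ k * E ^ k with hg
  have hfix : S * g * E = g := by
    have h1 := Finset.sum_range_succ (fun k => S ^ k * E ^ k) (q - 1)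
    rw [Finset.sum_range_succ', hS1, hE1, pow_zero, pow_zero, add_left_inj] at h1
    rw [hg, mul_neg, neg_mul, Finset.mul_sum, Finset.sum_mul, neg_inj, ← h1]
    refine (Finset.sum_congr rfl fun k _ => ?_)
    rw [pow_succ', pow_succ]
    simp only [mul_assoc]
  refine ⟨g, ⟨fun i => ?_, fun i j hij => ?_⟩, ?_⟩
  · have h1 (k : ℕ) : (S ^ k * E ^ k) i i = 1 := by
      rw [diag_mul_of_lower (lower_pow hSL k) (lower_pow hEL k),
        diag_pow_of_lower hSL, diag_pow_of_lower hEL, hSd, hE,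
        diagonal_apply_eq, ← mul_pow, mul_inv_cancel₀ (hA.2 i), one_pow]
    rw [hg, Matrix.neg_apply, Matrix.sum_apply, Finset.sum_congr rfl fun k _ => h1 k]
    simp [Nat.cast_sub (Fintype.card_pos (α := F)), q]
  · rw [hg, Matrix.neg_apply, Matrix.sum_apply,
      Finset.sum_eq_zero fun k _ => hterm k (toDual_lt_toDual.mpr hij), neg_zero]
  · conv_rhs => rw [← hfix]
    rw [mul_assoc _ E, hED, mul_one]

theorem exists_conj_of_isTriangular {A : Matrix (Fin n) (Fin n) F} (hA : IsTriangular A) :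
    ∃ g, IsUnitriangular g ∧ ∃ u ∈ centralizerU (fun i => A i i),
      A = g * (diagonal (fun i => A i i) * u) * g⁻¹ := by
  obtain ⟨g, hg, hSg⟩ := exists_isUnitriangular_pow_mul_eq hA
  have hL : A.BlockTriangular toDual := (isTriangular_iff.mp hA).1
  set S := A ^ Fintype.card F ^ n with hS
  set D := diagonal fun i => A i i with hD
  set E : Matrix (Fin n) (Fin n) F := diagonal fun i => (A i i)⁻¹ with hE
  have hDE : D * E = 1 := by
    rw [hE, hD, diagonal_mul_diagonal, ← diagonal_one]
    congr 1
    ext i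
    exact mul_inv_cancel₀ (hA.2 i)
  have hED : Commute E D := by
    rw [hE, hD, Commute, SemiconjBy, diagonal_mul_diagonal, diagonal_mul_diagonal]
    simp only [mul_comm]
  have hgS : g⁻¹ * S = D * g⁻¹ := by
    have h := congrArg (fun X => g⁻¹ * X * g⁻¹) hSg
    simpa only [Matrix.mul_assoc, Matrix.nonsing_inv_mul_cancel_left _ _ hg.isUnit_det,
      Matrix.mul_nonsing_inv _ hg.isUnit_det, mul_one] using h
  have hAS : A * S = S * A := (Commute.self_pow A _).eq
  have hC : Commute (g⁻¹ * A * g) D := by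
    calc g⁻¹ * A * g * D = g⁻¹ * (A * S) * g := by
          rw [mul_assoc, ← hSg]; simp only [mul_assoc]
      _ = (g⁻¹ * S) * A * g := by rw [hAS]; simp only [mul_assoc]
      _ = D * (g⁻¹ * A * g) := by rw [hgS]; simp only [mul_assoc]
  have hEL : E.BlockTriangular toDual := blockTriangular_diagonal _
  have hCL : (g⁻¹ * A * g).BlockTriangular toDual := (hg.inv.lower.mul hL).mul hg.lower
  refine ⟨g, hg, E * (g⁻¹ * A * g), ⟨⟨fun i => ?_, hEL.mul hCL⟩, hED.mul_left hC⟩, ?_⟩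
  · rw [diag_mul_of_lower hEL hCL, diag_mul_of_lower (hg.inv.lower.mul hL) hg.lower,
      diag_mul_of_lower hg.inv.lower hL, hg.1, hg.inv.1, hE, diagonal_apply_eq, one_mul, mul_one,
      inv_mul_cancel₀ (hA.2 i)]
  · rw [← mul_assoc D, hDE, one_mul]
    simp only [Matrix.mul_assoc, Matrix.mul_nonsing_inv_cancel_left _ _ hg.isUnit_det,
      Matrix.mul_nonsing_inv _ hg.isUnit_det, mul_one]

theorem ncard_conjugates_mul {d : Fin n → F} (hd0 : ∀ i, d i ≠ 0)
    {P : Set (Matrix (Fin n) (Fin n) F)}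
    (hP : P ⊆ centralizerU d) (hconj : ∀ x ∈ centralizerU d, ∀ w ∈ P, x⁻¹ * w * x ∈ P) :
    (conjugates d P).ncard * (centralizerU d).ncard =
      {u : Matrix (Fin n) (Fin n) F | IsUnitriangular u}.ncard * P.ncard := by
  classical
  choose! γ hγ ω hω hB using fun B (h : B ∈ conjugates d P) => h
  have hmul {w : Matrix (Fin n) (Fin n) F} (hw : w ∈ P) :
      (diagonal d * w) ^ Fintype.card F ^ n = diagonal d := by
    have hc : Commute (diagonal d) w := (hP hw).2.symm
    rw [hc.mul_pow, (hP hw).1.pow_card_pow_eq_one, diagonal_pow_card_pow, mul_one]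
  rw [← Set.ncard_prod, ← Set.ncard_prod]
  refine Set.ncard_congr (fun y _ => (γ y.1 * y.2, y.2⁻¹ * ω y.1 * y.2)) ?_ ?_ ?_
  · rintro ⟨B, x⟩ ⟨hBm, hx⟩
    exact ⟨(hγ B hBm).mul hx.1, hconj x hx _ (hω B hBm)⟩
  · rintro ⟨B, x⟩ ⟨B', x'⟩ ⟨hBm, hx⟩ ⟨hBm', hx'⟩ h
    have hrec {B x} (hBm : B ∈ conjugates d P) (hx : x ∈ centralizerU d) :
        B = (γ B * x) * (diagonal d * (x⁻¹ * ω B * x)) * (γ B * x)⁻¹ := by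
      conv_lhs => rw [hB B hBm]
      have hxd : x * diagonal d = diagonal d * x := hx.2
      rw [Matrix.mul_inv_rev]
      simp only [← mul_assoc]
      rw [mul_assoc (γ B) x, hxd]
      simp only [Matrix.mul_assoc, Matrix.mul_nonsing_inv_cancel_left _ _ hx.1.isUnit_det]
    obtain ⟨h1, h2⟩ := Prod.mk.inj h
    dsimp only at h1 h2 hBm hx hBm' hx'
    have hBB : B = B' := by rw [hrec hBm hx, hrec hBm' hx', h1, h2]
    subst hBB
    have hxx := congrArg (fun X => (γ B)⁻¹ * X) h1
    simp only [Matrix.nonsing_inv_mul_cancel_left _ _ (hγ B hBm).isUnit_det] at hxx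
    rw [hxx]
  · rintro ⟨g, w⟩ ⟨hg, hw⟩
    dsimp only at hg hw
    change IsUnitriangular g at hg
    set B := g * (diagonal d * w) * g⁻¹ with hBdef
    have hBm : B ∈ conjugates d P := ⟨g, hg, w, hw, rfl⟩
    have hγB := hγ B hBm
    have hBeq : g * (diagonal d * w) * g⁻¹ = γ B * (diagonal d * ω B) * (γ B)⁻¹ := hB B hBm
    have hd : g * diagonal d * g⁻¹ = γ B * diagonal d * (γ B)⁻¹ := by
      have h := congrArg (· ^ Fintype.card F ^ n) hBeq
      simpa only [conj_pow_of_isUnitriangular hg, conj_pow_of_isUnitriangular hγB, hmul hw,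
        hmul (hω B hBm)] using h
    have move {X Y : Matrix (Fin n) (Fin n) F} (h : g * X * g⁻¹ = γ B * Y * (γ B)⁻¹) :
        (γ B)⁻¹ * g * X = Y * ((γ B)⁻¹ * g) := by
      have h := congrArg (fun X => (γ B)⁻¹ * X * g) h
      simpa only [Matrix.mul_assoc, Matrix.nonsing_inv_mul_cancel_left _ _ hγB.isUnit_det,
        Matrix.nonsing_inv_mul _ hg.isUnit_det, mul_one] using h
    have hx : (γ B)⁻¹ * g ∈ centralizerU d := ⟨hγB.inv.mul hg, move hd⟩
    refine ⟨(B, (γ B)⁻¹ * g), ⟨hBm, hx⟩, Prod.ext ?_ ?_⟩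
    · exact Matrix.mul_nonsing_inv_cancel_left _ _ hγB.isUnit_det
    · have h := move hBeq
      rw [← mul_assoc, show (γ B)⁻¹ * g * diagonal d = diagonal d * ((γ B)⁻¹ * g) from hx.2,
        mul_assoc (diagonal d), mul_assoc (diagonal d)] at h
      have h' : (γ B)⁻¹ * g * w = ω B * ((γ B)⁻¹ * g) := by
        ext i j
        have hij := congrFun (congrFun h i) j
        rw [diagonal_mul, diagonal_mul] at hij
        exact mul_left_cancel₀ (hd0 i) hij
      dsimp only
      rw [mul_assoc, ← h', Matrix.nonsing_inv_mul_cancel_left _ _ hx.1.isUnit_det]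

theorem ncard_conjugates_centralizerPowers {d : Fin n → F} (hd0 : ∀ i, d i ≠ 0) (k : ℕ) :
    (conjugates d (centralizerPowers k d)).ncard =
      {u : Matrix (Fin n) (Fin n) F | IsUnitriangular u}.ncard / (centralizerU d).ncard *
        (centralizerPowers k d).ncard := by
  have hC : 0 < (centralizerU d).ncard :=
    (Set.ncard_pos (Set.toFinite _)).mpr ⟨1, one_mem_centralizerU d⟩
  have hdvd := ncard_conjugates_mul hd0 (P := {1})
    (by simpa using one_mem_centralizerU d)
    (by rintro x hx _ rfl; simp [Matrix.nonsing_inv_mul _ hx.1.isUnit_det])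
  have hpow := ncard_conjugates_mul hd0 (centralizerPowers_subset k d) (by
    rintro x hx _ ⟨u, hu, rfl⟩
    refine ⟨x⁻¹ * u * x, mul_mem_centralizerU
      (mul_mem_centralizerU (inv_mem_centralizerU hx) hu) hx, ?_⟩
    have h := conj_pow_of_isUnitriangular hx.1.inv u k
    rwa [Matrix.nonsing_inv_nonsing_inv _ hx.1.isUnit_det] at h)
  rw [Set.ncard_singleton, mul_one] at hdvd
  rw [← hdvd, Nat.mul_div_cancel _ hC]
  rw [← hdvd, mul_right_comm] at hpow
  exact Nat.eq_of_mul_eq_mul_right hC hpow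

theorem setOf_triangular_pow_diag_eq (p : ℕ) [Fact p.Prime] [CharP F p] {d : Fin n → F}
    (hd0 : ∀ i, d i ≠ 0) :
    {B : Matrix (Fin n) (Fin n) F | (∃ A, IsTriangular A ∧ A ^ p = B) ∧ B.diag = d} =
      conjugates d (centralizerPowers p d) := by
  have pow_eq {a : Fin n → F} {u : Matrix (Fin n) (Fin n) F} (hu : u ∈ centralizerU a) :
      (diagonal a * u) ^ p = diagonal (fun i => a i ^ p) * u ^ p := by
    rw [Commute.mul_pow (show Commute (diagonal a) u from hu.2.symm), diagonal_pow]
    rfl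
  ext B
  constructor
  · rintro ⟨⟨A, hA, rfl⟩, hdiag⟩
    have hd : d = fun i => A i i ^ p := by
      ext i
      rw [← hdiag, diag_apply, diag_pow_of_lower (isTriangular_iff.mp hA).1]
    obtain ⟨g, hg, u, hu, hAg⟩ := exists_conj_of_isTriangular hA
    refine ⟨g, hg, u ^ p, ⟨u, by rwa [hd, centralizerU_pow_char], rfl⟩, ?_⟩
    conv_lhs => rw [hAg]
    rw [conj_pow_of_isUnitriangular hg, pow_eq hu, hd]
  · rintro ⟨g, hg, _, ⟨u, hu, rfl⟩, rfl⟩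
    obtain ⟨a, ha⟩ : ∃ a : Fin n → F, d = fun i => a i ^ p := by
      choose a ha using fun i => surjective_frobenius F p (d i)
      exact ⟨a, funext fun i => (ha i).symm⟩
    rw [ha, centralizerU_pow_char] at hu
    have hp : p ≠ 0 := (Fact.out : p.Prime).ne_zero
    have ha0 (i : Fin n) : a i ≠ 0 := fun h => hd0 i (by simp [ha, h, hp])
    have hL : (diagonal a * u).BlockTriangular toDual :=
      (blockTriangular_diagonal _).mul hu.1.lower
    have hL' : (diagonal d * u ^ p).BlockTriangular toDual :=
      (blockTriangular_diagonal _).mul (hu.1.pow p).lower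
    refine ⟨⟨g * (diagonal a * u) * g⁻¹, isTriangular_iff.mpr
      ⟨(hg.lower.mul hL).mul hg.inv.lower, fun i => ?_⟩, ?_⟩, ?_⟩
    · rw [diag_conj_of_isUnitriangular hg hL, diagonal_mul, hu.1.1, mul_one]
      exact ha0 i
    · rw [conj_pow_of_isUnitriangular hg, pow_eq hu, ha]
    · ext i
      rw [diag_apply, diag_conj_of_isUnitriangular hg hL', diagonal_mul, (hu.1.pow p).1, mul_one]

end Finite

section FiberSizes

theorem exists_equiv_of_map_univ_eq {α β γ : Type*} [Fintype α] [Fintype β] [DecidableEq γ]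
    {f : α → γ} {g : β → γ}
    (h : (Finset.univ : Finset α).val.map f = (Finset.univ : Finset β).val.map g) :
    ∃ e : α ≃ β, ∀ a, g (e a) = f a := by
  have hcard (c : γ) : Nonempty ({a // f a = c} ≃ {b // g b = c}) := by
    rw [← Fintype.card_eq, Fintype.card_subtype, Fintype.card_subtype]
    have hc := congrArg (Multiset.count c) h
    rw [Multiset.count_map, Multiset.count_map] at hc
    simpa only [eq_comm (a := c), Finset.card_def, Finset.filter_val] using hc
  have e (c : γ) := (hcard c).some
  exact ⟨(Equiv.sigmaFiberEquiv f).symm.trans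
    ((Equiv.sigmaCongrRight e).trans (Equiv.sigmaFiberEquiv g)), fun a => (e (f a) ⟨a, rfl⟩).2⟩

variable {n : ℕ} {F : Type*} [DecidableEq F]

theorem typeMultiset_eq_map_univ (d : Fin n → F) :
    typeMultiset d = (Finset.univ : Finset {c // c ∈ Finset.image d Finset.univ}).val.map
      fun c => Fintype.card {i // d i = c.1} := by
  simp only [Fintype.card_subtype]
  exact (Multiset.attach_map_val' _ _).symm

/-- Two families of the same type have fibers that correspond under a permutation of the indices
which is increasing on each fiber. -/
theorem exists_perm_of_typeMultiset_eq {d d' : Fin n → F} (h : typeMultiset d = typeMultiset d') :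
    ∃ σ : Equiv.Perm (Fin n), (∀ i j, d' (σ i) = d' (σ j) ↔ d i = d j) ∧
      ∀ i j, d i = d j → (σ i < σ j ↔ i < j) := by
  rw [typeMultiset_eq_map_univ, typeMultiset_eq_map_univ] at h
  obtain ⟨e, he⟩ := exists_equiv_of_map_univ_eq h
  have hord (c : {c // c ∈ Finset.image d Finset.univ}) :
      Nonempty ({i // d i = c} ≃o {i // d' i = e c}) :=
    ⟨(Fintype.orderIsoFinOfCardEq _ rfl).symm.trans (Fintype.orderIsoFinOfCardEq _ (he c))⟩
  have o c := (hord c).some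
  have hmem (d : Fin n → F) (i : Fin n) : d i ∈ Finset.image d Finset.univ :=
    Finset.mem_image_of_mem _ (Finset.mem_univ i)
  let τ : Fin n → Fin n := fun i => o ⟨d i, hmem d i⟩ ⟨i, rfl⟩
  have hτ (i : Fin n) : d' (τ i) = e ⟨d i, hmem d i⟩ := (o ⟨d i, hmem d i⟩ ⟨i, rfl⟩).2
  have hfib (i j : Fin n) : d' (τ i) = d' (τ j) ↔ d i = d j := by
    rw [hτ, hτ, Subtype.coe_inj, e.injective.eq_iff, Subtype.mk.injEq]
  have hval (c : {c // c ∈ Finset.image d Finset.univ}) (i : Fin n) (hi : d i = c) :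
      τ i = o c ⟨i, hi⟩ := by
    obtain rfl : c = ⟨d i, hmem d i⟩ := Subtype.ext hi.symm
    rfl
  have hlt (i j : Fin n) (hij : d i = d j) : τ i < τ j ↔ i < j := by
    rw [hval ⟨d j, hmem d j⟩ i hij, hval ⟨d j, hmem d j⟩ j rfl, Subtype.coe_lt_coe,
      (o _).lt_iff_lt, Subtype.mk_lt_mk]
  have hinj : Function.Injective τ := by
    intro i j hij
    have hd := (hfib i j).mp (congrArg d' hij)
    rcases lt_trichotomy i j with hl | rfl | hl
    · exact absurd hij ((hlt i j hd).mpr hl).ne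
    · rfl
    · exact absurd hij ((hlt j i hd.symm).mpr hl).ne'
  exact ⟨Equiv.ofBijective τ (Finite.injective_iff_bijective.mp hinj), hfib, hlt⟩

variable [Field F]

theorem exists_algEquiv_image_centralizerU {d d' : Fin n → F}
    (h : typeMultiset d = typeMultiset d') :
    ∃ φ : Matrix (Fin n) (Fin n) F ≃ₐ[F] Matrix (Fin n) (Fin n) F,
      ∀ u, φ u ∈ centralizerU d' ↔ u ∈ centralizerU d := by
  obtain ⟨σ, hfib, hlt⟩ := exists_perm_of_typeMultiset_eq h
  refine ⟨reindexAlgEquiv F F σ, fun u => ?_⟩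
  have hentry (i j : Fin n) : reindexAlgEquiv F F σ u (σ i) (σ j) = u i j := by simp
  rw [mem_centralizerU_iff, mem_centralizerU_iff]
  constructor
  · rintro ⟨⟨h1, h2⟩, h3⟩
    have h3' (i j : Fin n) : u i j = 0 ∨ d i = d j := by
      rw [← hentry, ← hfib]
      exact h3 _ _
    refine ⟨⟨fun i => by rw [← hentry, h1], fun i j hij => ?_⟩, h3'⟩
    refine (h3' i j).elim id fun hd => ?_
    rw [← hentry, h2 _ _ ((hlt i j hd).mpr hij)]
  · rintro ⟨⟨h1, h2⟩, h3⟩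
    refine ⟨⟨fun i => ?_, fun i j hij => ?_⟩, fun i j => ?_⟩
    · obtain ⟨i, rfl⟩ := σ.surjective i
      rw [hentry, h1]
    · obtain ⟨i, rfl⟩ := σ.surjective i
      obtain ⟨j, rfl⟩ := σ.surjective j
      rw [hentry]
      exact (h3 i j).elim id fun hd => h2 i j ((hlt i j hd).mp hij)
    · obtain ⟨i, rfl⟩ := σ.surjective i
      obtain ⟨j, rfl⟩ := σ.surjective j
      rw [hentry, hfib]
      exact h3 i j

theorem ncard_centralizerU_eq {d d' : Fin n → F} (h : typeMultiset d = typeMultiset d') :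
    (centralizerU d).ncard = (centralizerU d').ncard := by
  obtain ⟨φ, hφ⟩ := exists_algEquiv_image_centralizerU h
  have himage : φ '' centralizerU d = centralizerU d' := by
    ext v
    obtain ⟨u, rfl⟩ := φ.surjective v
    rw [φ.injective.mem_set_image, hφ]
  rw [← himage, Set.ncard_image_of_injective _ φ.injective]

theorem ncard_centralizerPowers_eq (k : ℕ) {d d' : Fin n → F}
    (h : typeMultiset d = typeMultiset d') :
    (centralizerPowers k d).ncard = (centralizerPowers k d').ncard := by
  obtain ⟨φ, hφ⟩ := exists_algEquiv_image_centralizerU h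
  have himage : φ '' centralizerPowers k d = centralizerPowers k d' := by
    ext v
    constructor
    · rintro ⟨_, ⟨u, hu, rfl⟩, rfl⟩
      exact ⟨φ u, (hφ u).mpr hu, (map_pow φ u k).symm⟩
    · rintro ⟨v, hv, rfl⟩
      obtain ⟨u, rfl⟩ := φ.surjective v
      exact ⟨u ^ k, ⟨u, (hφ u).mp hv, rfl⟩, map_pow φ u k⟩
  rw [← himage, Set.ncard_image_of_injective _ φ.injective]

/-- The type of a family `d : Fin n → F`, as a partition of `n`. -/
def typePartition (d : Fin n → F) : Nat.Partition n where
  parts := typeMultiset d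
  parts_pos := by
    intro k hk
    obtain ⟨c, hc, rfl⟩ := Multiset.mem_map.mp hk
    obtain ⟨i, -, hi⟩ := Finset.mem_image.mp (Finset.mem_val.mp hc)
    exact Finset.card_pos.mpr ⟨i, by simpa using hi⟩
  parts_sum := by
    have h := Finset.card_eq_sum_card_image d Finset.univ
    rw [Finset.card_univ, Fintype.card_fin] at h
    exact h.symm

theorem card_typeMultiset_le [Fintype F] {d : Fin n → F} (hd0 : ∀ i, d i ≠ 0) :
    (typeMultiset d).card ≤ Fintype.card F - 1 := by
  rw [typeMultiset, Multiset.card_map, Finset.card_val, ← Finset.card_univ,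
    ← Finset.card_erase_of_mem (Finset.mem_univ (0 : F))]
  refine Finset.card_le_card fun c hc => ?_
  obtain ⟨i, -, rfl⟩ := Finset.mem_image.mp hc
  simpa using hd0 i

end FiberSizes

end pPowerPaper

theorem pPowerPaper.stmt14 (p e q : ℕ) (hp : p.Prime) (he : 0 < e) (hq : q = p ^ e)
    (hq2 : 2 < q) (F : Type*) [Field F] [Fintype F] [DecidableEq F]
    (hF : Fintype.card F = q) (n : ℕ) (hn : 0 < n)
    (dsel : Nat.Partition n → (Fin n → F))
    (hdsel : ∀ δ : Nat.Partition n, δ.parts.card ≤ q - 1 →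
      (∀ i, dsel δ i ≠ 0) ∧ typeMultiset (dsel δ) = δ.parts) :
    Set.ncard {B : Matrix (Fin n) (Fin n) F | ∃ A, IsTriangular A ∧ A ^ p = B}
      = ∑ δ ∈ Finset.univ.filter (fun δ : Nat.Partition n => δ.parts.card ≤ q - 1),
          Set.ncard {d : Fin n → F | (∀ i, d i ≠ 0) ∧ typeMultiset d = δ.parts} *
          (Set.ncard {u : Matrix (Fin n) (Fin n) F | IsUnitriangular u} /
            Set.ncard (centralizerU (dsel δ))) *
          Set.ncard {v : Matrix (Fin n) (Fin n) F |
            ∃ u ∈ centralizerU (dsel δ), u ^ p = v} := by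
  classical
  have := Fact.mk hp
  have : CharP F p := charP_of_card_eq_prime_pow (hF.trans hq)
  let N (d : Fin n → F) : ℕ :=
    {u : Matrix (Fin n) (Fin n) F | IsUnitriangular u}.ncard / (centralizerU d).ncard *
      (pPowerPaper.centralizerPowers p d).ncard
  have hfiber (d : Fin n → F) (hd : d ∈ Finset.univ.filter fun d : Fin n → F => ∀ i, d i ≠ 0) :
      ((Finset.univ.filter fun B : Matrix (Fin n) (Fin n) F =>
        ∃ A, IsTriangular A ∧ A ^ p = B).filter fun B => B.diag = d).card = N d := by
    have hd0 : ∀ i, d i ≠ 0 := by simpa using hd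
    change _ = _ / _ * _
    rw [← pPowerPaper.ncard_conjugates_centralizerPowers hd0,
      ← pPowerPaper.setOf_triangular_pow_diag_eq p hd0, Finset.filter_filter,
      Set.ncard_eq_toFinset_card', Set.toFinset_ofPred]
  have hdiag : Set.MapsTo (Matrix.diag (n := Fin n) (α := F))
      ↑(Finset.univ.filter fun B : Matrix (Fin n) (Fin n) F => ∃ A, IsTriangular A ∧ A ^ p = B)
      ↑(Finset.univ.filter fun d : Fin n → F => ∀ i, d i ≠ 0) := by
    intro B hB
    simp only [Finset.coe_filter, Finset.mem_univ, true_and, Set.mem_ofPred_eq] at hB ⊢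
    obtain ⟨A, hA, rfl⟩ := hB
    intro i
    rw [Matrix.diag_apply, pPowerPaper.diag_pow_of_lower (pPowerPaper.isTriangular_iff.mp hA).1]
    exact pow_ne_zero _ (hA.2 i)
  have htype : ∀ d ∈ Finset.univ.filter fun d : Fin n → F => ∀ i, d i ≠ 0,
      pPowerPaper.typePartition d ∈
        Finset.univ.filter fun δ : Nat.Partition n => δ.parts.card ≤ q - 1 := by
    intro d hd
    simp only [Finset.mem_filter, Finset.mem_univ, true_and] at hd ⊢
    rw [← hF]
    exact pPowerPaper.card_typeMultiset_le hd
  rw [Set.ncard_eq_toFinset_card', Set.toFinset_ofPred,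
    Finset.card_eq_sum_card_fiberwise hdiag, Finset.sum_congr rfl hfiber,
    ← Finset.sum_fiberwise_of_maps_to htype]
  refine Finset.sum_congr rfl fun δ hδ => ?_
  have hsel := (hdsel δ (by simpa using hδ)).2
  have hconst (d : Fin n → F) (hd : d ∈ (Finset.univ.filter fun d : Fin n → F =>
      ∀ i, d i ≠ 0).filter fun d => pPowerPaper.typePartition d = δ) : N d = N (dsel δ) := by
    have hd' : typeMultiset d = typeMultiset (dsel δ) := by
      rw [hsel, ← (Finset.mem_filter.mp hd).2]
      rfl
    simp only [N]
    rw [pPowerPaper.ncard_centralizerU_eq hd', pPowerPaper.ncard_centralizerPowers_eq p hd']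
  rw [Finset.sum_congr rfl hconst, Finset.sum_const, smul_eq_mul, mul_assoc]
  congr 1
  rw [Set.ncard_eq_toFinset_card', Set.toFinset_ofPred, Finset.filter_filter]
  simp only [Nat.Partition.ext_iff, pPowerPaper.typePartition]
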